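/- Let M be a finite-dimensional Lie superalgebra over a field of characteristic ≠ 2, 3. Then M □ M ≅ (M/M²) □ (M/M²) ≅ Γ(M/M²). -/

import Mathlib

open Module Function TensorProduct

universe u v w x y z

/-- The sign `(-1)^(ab)` for degrees `a b : ZMod 2`, as an element of the field `F`. -/
def sgn (F : Type u) [Field F] (a b : ZMod 2) : F :=
  if a = 1 ∧ b = 1 then -1 else 1

/-- A supermodule (ℤ/2-graded vector space) over `F`. -/
class SuperModule (F : Type u) (V : Type v) [Field F] [AddCommGroup V] [Module F V] where
  grade : ZMod 2 → Submodule F V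
  isCompl_grade : IsCompl (grade 0) (grade 1)

/-- The graded piece of degree `a`. -/
abbrev gr (F : Type u) (V : Type v) [Field F] [AddCommGroup V] [Module F V]
    [s : SuperModule F V] (a : ZMod 2) : Submodule F V := s.grade a

/-- A Lie superalgebra structure on a supermodule. -/
class LieSuperAlgebra (F : Type u) (L : Type v) [Field F] [AddCommGroup L] [Module F L]
    [SuperModule F L] where
  bracket : L →ₗ[F] L →ₗ[F] L
  bracket_grade : ∀ (a b : ZMod 2) (x y : L), x ∈ gr F L a → y ∈ gr F L b →
    bracket x y ∈ gr F L (a + b)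
  skew : ∀ (a b : ZMod 2) (x y : L), x ∈ gr F L a → y ∈ gr F L b →
    bracket x y = -(sgn F a b) • bracket y x
  jacobi : ∀ (a b c : ZMod 2) (x y zz : L), x ∈ gr F L a → y ∈ gr F L b → zz ∈ gr F L c →
    sgn F a c • bracket x (bracket y zz) + sgn F b a • bracket y (bracket zz x)
      + sgn F c b • bracket zz (bracket x y) = 0

/-- The bracket of a Lie superalgebra. -/
abbrev br (F : Type u) (L : Type v) [Field F] [AddCommGroup L] [Module F L] [SuperModule F L]
    [s : LieSuperAlgebra F L] : L →ₗ[F] L →ₗ[F] L := s.bracket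

/-- A graded submodule. -/
def IsGradedSub (F : Type u) {V : Type v} [Field F] [AddCommGroup V] [Module F V]
    [SuperModule F V] (N : Submodule F V) : Prop :=
  N ≤ (N ⊓ gr F V 0) ⊔ (N ⊓ gr F V 1)

section LSADefs

variable (F : Type u) [Field F]
variable (L : Type v) [AddCommGroup L] [Module F L] [SuperModule F L] [LieSuperAlgebra F L]

/-- The derived subalgebra `L² = [L, L]`. -/
def derivedSub : Submodule F L := Submodule.span F {t | ∃ x y : L, br F L x y = t}

/-- The center `Z(L)`. -/
def centerSub : Submodule F L := ⨅ x : L, LinearMap.ker ((br F L).flip x)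

/-- The span of brackets `[A, B]` of two submodules. -/
def bracketSub (A B : Submodule F L) : Submodule F L :=
  Submodule.span F {t | ∃ x ∈ A, ∃ y ∈ B, br F L x y = t}

/-- Abelian Lie superalgebra. -/
def IsAbelianLSA : Prop := ∀ x y : L, br F L x y = 0

/-- The lower central series. -/
def lcs : ℕ → Submodule F L
  | 0 => ⊤
  | n + 1 => Submodule.span F {t | ∃ x : L, ∃ y ∈ lcs n, br F L x y = t}

/-- Nilpotent Lie superalgebra. -/
def IsNilpotentLSA : Prop := ∃ n : ℕ, lcs F L n = ⊥

end LSADefs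

/-- Homomorphism of Lie superalgebras: an even linear map preserving grading and bracket. -/
structure LieSuperHom (F : Type u) (L : Type v) (M : Type w) [Field F]
    [AddCommGroup L] [Module F L] [SuperModule F L] [LieSuperAlgebra F L]
    [AddCommGroup M] [Module F M] [SuperModule F M] [LieSuperAlgebra F M]
    extends L →ₗ[F] M where
  map_grade : ∀ (a : ZMod 2) (x : L), x ∈ gr F L a → toLinearMap x ∈ gr F M a
  map_bracket : ∀ x y : L, toLinearMap (br F L x y) = br F M (toLinearMap x) (toLinearMap y)

/-- Isomorphism of Lie superalgebras. -/
def LSAIsomorphic (F : Type u) (L : Type v) (M : Type w) [Field F]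
    [AddCommGroup L] [Module F L] [SuperModule F L] [LieSuperAlgebra F L]
    [AddCommGroup M] [Module F M] [SuperModule F M] [LieSuperAlgebra F M] : Prop :=
  ∃ f : LieSuperHom F L M, Function.Bijective f.toLinearMap

/-- `Q` is (a realization of) the quotient `L / L²`, i.e. the abelianization of `L`. -/
def IsQuotientByDerived (F : Type u) (L : Type v) (Q : Type w) [Field F]
    [AddCommGroup L] [Module F L] [SuperModule F L] [LieSuperAlgebra F L]
    [AddCommGroup Q] [Module F Q] [SuperModule F Q] [LieSuperAlgebra F Q] : Prop :=
  ∃ f : LieSuperHom F L Q, Function.Surjective f.toLinearMap ∧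
    LinearMap.ker f.toLinearMap = derivedSub F L

/-- An action of the Lie superalgebra `P` on the Lie superalgebra `M`. -/
structure LieSuperAction (F : Type u) (P : Type v) (M : Type w) [Field F]
    [AddCommGroup P] [Module F P] [SuperModule F P] [LieSuperAlgebra F P]
    [AddCommGroup M] [Module F M] [SuperModule F M] [LieSuperAlgebra F M] where
  act : P →ₗ[F] M →ₗ[F] M
  act_grade : ∀ (a b : ZMod 2) (p : P) (m : M), p ∈ gr F P a → m ∈ gr F M b →
    act p m ∈ gr F M (a + b)
  act_bracket : ∀ (a b : ZMod 2) (p p' : P) (m : M), p ∈ gr F P a → p' ∈ gr F P b →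
    act (br F P p p') m = act p (act p' m) - sgn F a b • act p' (act p m)
  act_lie : ∀ (a b : ZMod 2) (p : P) (m m' : M), p ∈ gr F P a → m ∈ gr F M b →
    act p (br F M m m') = br F M (act p m) m' + sgn F a b • br F M m (act p m')

/-- A trivial action. -/
def LieSuperAction.IsTrivial {F : Type u} {P : Type v} {M : Type w} [Field F]
    [AddCommGroup P] [Module F P] [SuperModule F P] [LieSuperAlgebra F P]
    [AddCommGroup M] [Module F M] [SuperModule F M] [LieSuperAlgebra F M]
    (α : LieSuperAction F P M) : Prop := ∀ (p : P) (m : M), α.act p m = 0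

/-- The trivial action of `P` on `M`. -/
def trivialAction (F : Type u) (P : Type v) (M : Type w) [Field F]
    [AddCommGroup P] [Module F P] [SuperModule F P] [LieSuperAlgebra F P]
    [AddCommGroup M] [Module F M] [SuperModule F M] [LieSuperAlgebra F M] :
    LieSuperAction F P M where
  act := 0
  act_grade := by
    intro a b p m _ _
    simp only [LinearMap.zero_apply]
    exact (gr F M (a + b)).zero_mem
  act_bracket := by intro a b p p' m _ _; simp
  act_lie := by intro a b p m m' _ _; simp

/-- A Lie superpairing on `M × N` (relative to mutual actions) with values in the
Lie superalgebra `T`; these are exactly the defining relations of the non-abelian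
tensor product `M ⊗ N`. -/
structure SuperPairing (F : Type u) (M : Type v) (N : Type w) (T : Type x) [Field F]
    [AddCommGroup M] [Module F M] [SuperModule F M] [LieSuperAlgebra F M]
    [AddCommGroup N] [Module F N] [SuperModule F N] [LieSuperAlgebra F N]
    [AddCommGroup T] [Module F T] [SuperModule F T] [LieSuperAlgebra F T]
    (α : LieSuperAction F M N) (β : LieSuperAction F N M) where
  pair : M →ₗ[F] N →ₗ[F] T
  pair_grade : ∀ (a b : ZMod 2) (m : M) (n : N), m ∈ gr F M a → n ∈ gr F N b →
    pair m n ∈ gr F T (a + b)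
  rel1 : ∀ (a b : ZMod 2) (m m' : M) (n : N), m ∈ gr F M a → m' ∈ gr F M b →
    pair (br F M m m') n = pair m (α.act m' n) - sgn F a b • pair m' (α.act m n)
  rel2 : ∀ (a b c : ZMod 2) (m : M) (n n' : N), m ∈ gr F M a → n ∈ gr F N b → n' ∈ gr F N c →
    pair m (br F N n n') = sgn F c (a + b) • pair (β.act n' m) n - sgn F a b • pair (β.act n m) n'
  rel3 : ∀ (a b : ZMod 2) (m : M) (n : N) (m' : M) (n' : N), m ∈ gr F M a → n ∈ gr F N b →
    br F T (pair m n) (pair m' n') = - sgn F a b • pair (β.act n m) (α.act m' n')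

/-- `T`, together with the pairing `p`, is (a realization of) the non-abelian tensor
product `M ⊗ N`: it satisfies the universal property among Lie superpairings. -/
def IsTensorProductLSA (F : Type u) (M : Type v) (N : Type w) (T : Type x) [Field F]
    [AddCommGroup M] [Module F M] [SuperModule F M] [LieSuperAlgebra F M]
    [AddCommGroup N] [Module F N] [SuperModule F N] [LieSuperAlgebra F N]
    [AddCommGroup T] [Module F T] [SuperModule F T] [LieSuperAlgebra F T]
    (α : LieSuperAction F M N) (β : LieSuperAction F N M)
    (p : SuperPairing F M N T α β) : Prop :=
  ∀ (T' : Type (max u v w x)) [AddCommGroup T'] [Module F T'] [SuperModule F T']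
    [LieSuperAlgebra F T'] (q : SuperPairing F M N T' α β),
    ∃! h : LieSuperHom F T T', ∀ (m : M) (n : N), h.toLinearMap (p.pair m n) = q.pair m n

/-- A Lie superpairing for the tensor square `L ⊗ L` (with adjoint actions):
the defining relations of the non-abelian tensor square. -/
structure TensorSqPairing (F : Type u) (L : Type v) (T : Type w) [Field F]
    [AddCommGroup L] [Module F L] [SuperModule F L] [LieSuperAlgebra F L]
    [AddCommGroup T] [Module F T] [SuperModule F T] [LieSuperAlgebra F T] where
  pair : L →ₗ[F] L →ₗ[F] T
  pair_grade : ∀ (a b : ZMod 2) (x y : L), x ∈ gr F L a → y ∈ gr F L b →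
    pair x y ∈ gr F T (a + b)
  rel1 : ∀ (a b : ZMod 2) (x x' y : L), x ∈ gr F L a → x' ∈ gr F L b →
    pair (br F L x x') y = pair x (br F L x' y) - sgn F a b • pair x' (br F L x y)
  rel2 : ∀ (a b c : ZMod 2) (x y y' : L), x ∈ gr F L a → y ∈ gr F L b → y' ∈ gr F L c →
    pair x (br F L y y') = sgn F c (a + b) • pair (br F L y' x) y
      - sgn F a b • pair (br F L y x) y'
  rel3 : ∀ (a b : ZMod 2) (x y x' y' : L), x ∈ gr F L a → y ∈ gr F L b →
    br F T (pair x y) (pair x' y') = - sgn F a b • pair (br F L y x) (br F L x' y')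

/-- `T`, together with the pairing `p`, is (a realization of) the non-abelian tensor
square `L ⊗ L`. -/
def IsTensorSquare (F : Type u) (L : Type v) (T : Type w) [Field F]
    [AddCommGroup L] [Module F L] [SuperModule F L] [LieSuperAlgebra F L]
    [AddCommGroup T] [Module F T] [SuperModule F T] [LieSuperAlgebra F T]
    (p : TensorSqPairing F L T) : Prop :=
  ∀ (T' : Type (max u v w)) [AddCommGroup T'] [Module F T'] [SuperModule F T']
    [LieSuperAlgebra F T'] (q : TensorSqPairing F L T'),
    ∃! h : LieSuperHom F T T', ∀ x y : L, h.toLinearMap (p.pair x y) = q.pair x y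

/-- The submodule `L □ L` of a realization `T` of `L ⊗ L`, generated by the elements
`x ⊗ x' + (-1)^{|x||x'|} (x' ⊗ x)` (homogeneous `x, x'`) and `x₀ ⊗ x₀` (`x₀` even). -/
def squareBox (F : Type u) (L : Type v) (T : Type w) [Field F]
    [AddCommGroup L] [Module F L] [SuperModule F L] [LieSuperAlgebra F L]
    [AddCommGroup T] [Module F T] [SuperModule F T] [LieSuperAlgebra F T]
    (p : TensorSqPairing F L T) : Submodule F T :=
  Submodule.span F
    ({t | ∃ (a b : ZMod 2) (x y : L), x ∈ gr F L a ∧ y ∈ gr F L b ∧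
        t = p.pair x y + sgn F a b • p.pair y x} ∪
      {t | ∃ x ∈ gr F L 0, t = p.pair x x})

/-- Data of a "universal quadratic functor" target: maps satisfying the defining
relations of `Γ(V)`. -/
structure GammaData (F : Type u) (V : Type v) (W : Type w) [Field F]
    [AddCommGroup V] [Module F V] [SuperModule F V] [AddCommGroup W] [Module F W] where
  gam : V → W
  bil : V →ₗ[F] V →ₗ[F] W
  gam_smul : ∀ (c : F) (v : V), v ∈ gr F V 0 → gam (c • v) = (c * c) • gam v
  gam_add : ∀ v w' : V, v ∈ gr F V 0 → w' ∈ gr F V 0 →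
    gam (v + w') - gam v - gam w' = bil v w'
  bil_symm : ∀ (a b : ZMod 2) (v w' : V), v ∈ gr F V a → w' ∈ gr F V b →
    bil v w' = sgn F a b • bil w' v
  bil_alt : ∀ v : V, v ∈ gr F V 1 → bil v v = 0

/-- `W`, with data `d`, is (a realization of) the universal quadratic functor `Γ(V)`. -/
def IsGamma (F : Type u) (V : Type v) (W : Type w) [Field F]
    [AddCommGroup V] [Module F V] [SuperModule F V] [AddCommGroup W] [Module F W]
    (d : GammaData F V W) : Prop :=
  ∀ (W' : Type (max u v w)) [AddCommGroup W'] [Module F W'] (d' : GammaData F V W'),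
    ∃! h : W →ₗ[F] W',
      (∀ v ∈ gr F V 0, h (d.gam v) = d'.gam v) ∧ (∀ v w' : V, h (d.bil v w') = d'.bil v w')

/-- `Fr` is a free Lie superalgebra on the graded set `(X, deg)` with inclusion `ι`. -/
def IsFreeLSA (F : Type u) (X : Type v) (deg : X → ZMod 2) (Fr : Type w) [Field F]
    [AddCommGroup Fr] [Module F Fr] [SuperModule F Fr] [LieSuperAlgebra F Fr]
    (ι : X → Fr) : Prop :=
  (∀ x : X, ι x ∈ gr F Fr (deg x)) ∧
  ∀ (K : Type (max u v w)) [AddCommGroup K] [Module F K] [SuperModule F K]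
    [LieSuperAlgebra F K] (f : X → K), (∀ x : X, f x ∈ gr F K (deg x)) →
    ∃! h : LieSuperHom F Fr K, ∀ x : X, h.toLinearMap (ι x) = f x

/-- Dimension of the degree-`a` part of the Schur multiplier `(R ∩ [Fr,Fr])/[Fr,R]`
attached to a free presentation with kernel `R`. -/
noncomputable def schurDim (F : Type u) (Fr : Type v) [Field F] [AddCommGroup Fr]
    [Module F Fr] [SuperModule F Fr] [LieSuperAlgebra F Fr]
    (R : Submodule F Fr) (a : ZMod 2) : ℕ :=
  finrank F ((R ⊓ derivedSub F Fr ⊓ gr F Fr a).map (bracketSub F Fr ⊤ R).mkQ)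

/-- `L` is (isomorphic to) the Heisenberg Lie superalgebra `H(m, n)` with even center:
it admits a homogeneous basis `x₁,…,x_{2m}, y₁,…,y_n, z` with the defining brackets. -/
def IsHmn (F : Type u) (m n : ℕ) (L : Type v) [Field F]
    [AddCommGroup L] [Module F L] [SuperModule F L] [LieSuperAlgebra F L] : Prop :=
  ∃ (xv : Fin (2 * m) → L) (yv : Fin n → L) (zv : L)
    (B : Basis ((Fin (2 * m)) ⊕ (Fin n) ⊕ Unit) F L),
    (∀ i, B (Sum.inl i) = xv i) ∧ (∀ j, B (Sum.inr (Sum.inl j)) = yv j) ∧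
    B (Sum.inr (Sum.inr ())) = zv ∧
    (∀ i, xv i ∈ gr F L 0) ∧ (∀ j, yv j ∈ gr F L 1) ∧ zv ∈ gr F L 0 ∧
    (∀ i j : Fin (2 * m), br F L (xv i) (xv j) =
      if (j : ℕ) = (i : ℕ) + m then zv else if (i : ℕ) = (j : ℕ) + m then -zv else 0) ∧
    (∀ (i : Fin (2 * m)) (j : Fin n), br F L (xv i) (yv j) = 0) ∧
    (∀ (j : Fin n) (i : Fin (2 * m)), br F L (yv j) (xv i) = 0) ∧
    (∀ j k : Fin n, br F L (yv j) (yv k) = if j = k then zv else 0) ∧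
    (∀ i, br F L (xv i) zv = 0) ∧ (∀ i, br F L zv (xv i) = 0) ∧
    (∀ j, br F L (yv j) zv = 0) ∧ (∀ j, br F L zv (yv j) = 0) ∧
    br F L zv zv = 0

/-- `L` is (isomorphic to) the Heisenberg Lie superalgebra `H_m` with odd center. -/
def IsHmOdd (F : Type u) (m : ℕ) (L : Type v) [Field F]
    [AddCommGroup L] [Module F L] [SuperModule F L] [LieSuperAlgebra F L] : Prop :=
  ∃ (xv yv : Fin m → L) (zv : L) (B : Basis ((Fin m) ⊕ (Fin m) ⊕ Unit) F L),
    (∀ i, B (Sum.inl i) = xv i) ∧ (∀ j, B (Sum.inr (Sum.inl j)) = yv j) ∧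
    B (Sum.inr (Sum.inr ())) = zv ∧
    (∀ i, xv i ∈ gr F L 0) ∧ (∀ j, yv j ∈ gr F L 1) ∧ zv ∈ gr F L 1 ∧
    (∀ i j, br F L (xv i) (xv j) = 0) ∧
    (∀ i j, br F L (xv i) (yv j) = if i = j then zv else 0) ∧
    (∀ i j, br F L (yv i) (xv j) = if i = j then -zv else 0) ∧
    (∀ i j, br F L (yv i) (yv j) = 0) ∧
    (∀ i, br F L (xv i) zv = 0) ∧ (∀ i, br F L zv (xv i) = 0) ∧
    (∀ j, br F L (yv j) zv = 0) ∧ (∀ j, br F L zv (yv j) = 0) ∧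
    br F L zv zv = 0

/-- `A` is (isomorphic to) the abelian Lie superalgebra `A(a | b)`. -/
def IsAbelianOfDim (F : Type u) (a b : ℕ) (A : Type v) [Field F]
    [AddCommGroup A] [Module F A] [SuperModule F A] [LieSuperAlgebra F A] : Prop :=
  IsAbelianLSA F A ∧ finrank F (gr F A 0) = a ∧ finrank F (gr F A 1) = b

/-- Heisenberg Lie superalgebra with even center: `Z(L) = L²` is one-dimensional,
spanned by a nonzero even element. -/
def IsHeisenbergEven (F : Type u) (L : Type v) [Field F]
    [AddCommGroup L] [Module F L] [SuperModule F L] [LieSuperAlgebra F L] : Prop :=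
  centerSub F L = derivedSub F L ∧
  ∃ zc : L, zc ≠ 0 ∧ zc ∈ gr F L 0 ∧ centerSub F L = Submodule.span F {zc}

/-- Heisenberg Lie superalgebra with odd center. -/
def IsHeisenbergOdd (F : Type u) (L : Type v) [Field F]
    [AddCommGroup L] [Module F L] [SuperModule F L] [LieSuperAlgebra F L] : Prop :=
  centerSub F L = derivedSub F L ∧
  ∃ zc : L, zc ≠ 0 ∧ zc ∈ gr F L 1 ∧ centerSub F L = Submodule.span F {zc}

/-- `P ≅ L ⊕ M` as Lie superalgebras (internal direct sum of two commuting copies). -/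
def IsDirectSumOf (F : Type u) (P : Type v) (L : Type w) (M : Type x) [Field F]
    [AddCommGroup P] [Module F P] [SuperModule F P] [LieSuperAlgebra F P]
    [AddCommGroup L] [Module F L] [SuperModule F L] [LieSuperAlgebra F L]
    [AddCommGroup M] [Module F M] [SuperModule F M] [LieSuperAlgebra F M] : Prop :=
  ∃ (f : LieSuperHom F L P) (g : LieSuperHom F M P),
    Function.Bijective (fun q : L × M => f.toLinearMap q.1 + g.toLinearMap q.2) ∧
    (∀ (x : L) (y : M), br F P (f.toLinearMap x) (g.toLinearMap y) = 0) ∧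
    (∀ (y : M) (x : L), br F P (g.toLinearMap y) (f.toLinearMap x) = 0)

/-- `S ≅ A ⊕ B ⊕ C ⊕ D` as Lie superalgebras. -/
def IsDirectSumOf4 (F : Type u) (S : Type v) (A : Type w) (B : Type x) (C : Type y)
    (D : Type z) [Field F]
    [AddCommGroup S] [Module F S] [SuperModule F S] [LieSuperAlgebra F S]
    [AddCommGroup A] [Module F A] [SuperModule F A] [LieSuperAlgebra F A]
    [AddCommGroup B] [Module F B] [SuperModule F B] [LieSuperAlgebra F B]
    [AddCommGroup C] [Module F C] [SuperModule F C] [LieSuperAlgebra F C]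
    [AddCommGroup D] [Module F D] [SuperModule F D] [LieSuperAlgebra F D] : Prop :=
  ∃ (f : LieSuperHom F A S) (g : LieSuperHom F B S) (h : LieSuperHom F C S)
    (k : LieSuperHom F D S),
    Function.Bijective (fun q : A × B × C × D =>
      f.toLinearMap q.1 + g.toLinearMap q.2.1 + h.toLinearMap q.2.2.1
        + k.toLinearMap q.2.2.2) ∧
    (∀ u v', br F S (f.toLinearMap u) (g.toLinearMap v') = 0) ∧
    (∀ u v', br F S (f.toLinearMap u) (h.toLinearMap v') = 0) ∧
    (∀ u v', br F S (f.toLinearMap u) (k.toLinearMap v') = 0) ∧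
    (∀ u v', br F S (g.toLinearMap u) (h.toLinearMap v') = 0) ∧
    (∀ u v', br F S (g.toLinearMap u) (k.toLinearMap v') = 0) ∧
    (∀ u v', br F S (h.toLinearMap u) (k.toLinearMap v') = 0)

/-- `L ≅ H(m, n) ⊕ A(a | b)`: an internal decomposition into a Heisenberg part with
even center, spanned by homogeneous elements with the defining brackets, and a central
abelian graded complement of dimension `(a | b)`. -/
def DecompHeisenbergAbelian (F : Type u) (L : Type v) [Field F]
    [AddCommGroup L] [Module F L] [SuperModule F L] [LieSuperAlgebra F L]
    (m n a b : ℕ) : Prop :=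
  ∃ (xv : Fin (2 * m) → L) (yv : Fin n → L) (zv : L) (A : Submodule F L),
    (∀ i, xv i ∈ gr F L 0) ∧ (∀ j, yv j ∈ gr F L 1) ∧ zv ∈ gr F L 0 ∧
    IsGradedSub F A ∧
    finrank F (A ⊓ gr F L 0 : Submodule F L) = a ∧
    finrank F (A ⊓ gr F L 1 : Submodule F L) = b ∧
    (∀ u ∈ A, ∀ v : L, br F L u v = 0 ∧ br F L v u = 0) ∧
    LinearIndependent F (Sum.elim xv (Sum.elim yv (fun _ : Unit => zv))) ∧
    Disjoint (Submodule.span F (Set.range (Sum.elim xv (Sum.elim yv (fun _ : Unit => zv))))) A ∧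
    Submodule.span F (Set.range (Sum.elim xv (Sum.elim yv (fun _ : Unit => zv)))) ⊔ A = ⊤ ∧
    (∀ i j : Fin (2 * m), br F L (xv i) (xv j) =
      if (j : ℕ) = (i : ℕ) + m then zv else if (i : ℕ) = (j : ℕ) + m then -zv else 0) ∧
    (∀ (i : Fin (2 * m)) (j : Fin n), br F L (xv i) (yv j) = 0) ∧
    (∀ (j : Fin n) (i : Fin (2 * m)), br F L (yv j) (xv i) = 0) ∧
    (∀ j k : Fin n, br F L (yv j) (yv k) = if j = k then zv else 0) ∧
    (∀ i, br F L (xv i) zv = 0) ∧ (∀ i, br F L zv (xv i) = 0) ∧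
    (∀ j, br F L (yv j) zv = 0) ∧ (∀ j, br F L zv (yv j) = 0) ∧
    br F L zv zv = 0

/-- The submodule of a realization of `I ⊗ J` (for graded ideals `I, J` of `M`)
generated by `x ⊗ y + (-1)^(|x||y|) y ⊗ x` and `x₀ ⊗ x₀` for `x, y, x₀ ∈ I ∩ J`,
`x₀` even. -/
def pairBox (F : Type u) (I : Type v) (J : Type w) (TIJ : Type x) (M : Type y) [Field F]
    [AddCommGroup I] [Module F I] [SuperModule F I] [LieSuperAlgebra F I]
    [AddCommGroup J] [Module F J] [SuperModule F J] [LieSuperAlgebra F J]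
    [AddCommGroup TIJ] [Module F TIJ] [SuperModule F TIJ] [LieSuperAlgebra F TIJ]
    [AddCommGroup M] [Module F M] [SuperModule F M] [LieSuperAlgebra F M]
    (ι : LieSuperHom F I M) (κ : LieSuperHom F J M)
    (α : LieSuperAction F I J) (β : LieSuperAction F J I)
    (p : SuperPairing F I J TIJ α β) : Submodule F TIJ :=
  Submodule.span F
    ({t | ∃ (a b : ZMod 2) (i i' : I) (j j' : J),
        ι.toLinearMap i = κ.toLinearMap j ∧ ι.toLinearMap i' = κ.toLinearMap j' ∧
        ι.toLinearMap i ∈ gr F M a ∧ ι.toLinearMap i' ∈ gr F M b ∧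
        t = p.pair i j' + sgn F a b • p.pair i' j} ∪
      {t | ∃ (i : I) (j : J), ι.toLinearMap i = κ.toLinearMap j ∧
        ι.toLinearMap i ∈ gr F M 0 ∧ t = p.pair i j})

section Helpers

variable {F : Type u} [Field F]

theorem hp_two_ne (h : ringChar F ≠ 2) : (2 : F) ≠ 0 := Ring.two_ne_zero h

theorem hp_sgn00 : sgn F 0 0 = 1 := by simp [sgn]
theorem hp_sgn01 : sgn F 0 1 = 1 := by simp [sgn]
theorem hp_sgn10 : sgn F 1 0 = 1 := by simp [sgn]
theorem hp_sgn11 : sgn F 1 1 = -1 := by simp [sgn]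

theorem hp_zmod (a : ZMod 2) : a = 0 ∨ a = 1 := by
  revert a; decide

section Proj
variable {V : Type v} [AddCommGroup V] [Module F V] [SuperModule F V]

variable (F V) in
/-- even projection -/
noncomputable def hpE : V →ₗ[F] V :=
  (gr F V 0).projection (gr F V 1) SuperModule.isCompl_grade

variable (F V) in
/-- odd projection -/
noncomputable def hpO : V →ₗ[F] V := LinearMap.id - hpE F V

theorem hpE_even {x : V} (h : x ∈ gr F V 0) : hpE F V x = x :=
  Submodule.projection_apply_left SuperModule.isCompl_grade ⟨x, h⟩

theorem hpE_odd {x : V} (h : x ∈ gr F V 1) : hpE F V x = 0 :=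
  Submodule.projection_apply_right SuperModule.isCompl_grade ⟨x, h⟩

theorem hpO_even {x : V} (h : x ∈ gr F V 0) : hpO F V x = 0 := by
  simp [hpO, hpE_even h]

theorem hpO_odd {x : V} (h : x ∈ gr F V 1) : hpO F V x = x := by
  simp [hpO, hpE_odd h]

theorem hpE_mem (x : V) : hpE F V x ∈ gr F V 0 :=
  Submodule.projection_apply_mem SuperModule.isCompl_grade x

theorem hpO_mem (x : V) : hpO F V x ∈ gr F V 1 := by
  have h : hpE F V (hpO F V x) = 0 := by
    simp [hpO, hpE_even (hpE_mem x)]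
  exact (Submodule.projection_apply_eq_zero_iff SuperModule.isCompl_grade).1 h

theorem hp_add (x : V) : hpE F V x + hpO F V x = x := by simp [hpO]

variable (F) in
@[elab_as_elim]
theorem hp_ind {P : V → Prop} (x : V) (h : ∀ a, ∀ x ∈ gr F V a, P x)
    (hadd : ∀ x y, P x → P y → P (x + y)) : P x := by
  rw [← hp_add (F := F) x]
  exact hadd _ _ (h 0 _ (hpE_mem x)) (h 1 _ (hpO_mem x))

variable {W : Type w} [AddCommGroup W] [Module F W]

/-- super-flip -/
noncomputable def hpFlip (B : V →ₗ[F] V →ₗ[F] W) : V →ₗ[F] V →ₗ[F] W :=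
  B.flip - (2 : F) • (B.compl₁₂ (hpO F V) (hpO F V)).flip

theorem hpFlip_apply (B : V →ₗ[F] V →ₗ[F] W) (a b : ZMod 2) (x y : V)
    (hx : x ∈ gr F V a) (hy : y ∈ gr F V b) : hpFlip B x y = sgn F a b • B y x := by
  rcases hp_zmod a with rfl | rfl <;> rcases hp_zmod b with rfl | rfl <;>
    simp [hpFlip, hp_sgn00, hp_sgn01, hp_sgn10, hp_sgn11, hpO_even, hpO_odd, hx, hy]
  module

end Proj

section Gam
variable (F) (V : Type v) [AddCommGroup V] [Module F V] [SuperModule F V]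

/-- relations -/
def hpRel : Submodule F (V ⊗[F] V) :=
  Submodule.span F {t | ∃ (a b : ZMod 2) (x y : V), x ∈ gr F V a ∧ y ∈ gr F V b ∧
    t = x ⊗ₜ[F] y - sgn F a b • (y ⊗ₜ[F] x)}

/-- concrete Gamma -/
abbrev HpGam : Type v := (V ⊗[F] V) ⧸ hpRel F V

variable {V}

/-- symbol -/
def hpMk : V →ₗ[F] V →ₗ[F] HpGam F V := (TensorProduct.mk F V V).compr₂ (hpRel F V).mkQ

theorem hpMk_symm (a b : ZMod 2) (x y : V) (hx : x ∈ gr F V a) (hy : y ∈ gr F V b) :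
    hpMk F x y = sgn F a b • hpMk F y x := by
  have : x ⊗ₜ[F] y - sgn F a b • (y ⊗ₜ[F] x) ∈ hpRel F V :=
    Submodule.subset_span ⟨a, b, x, y, hx, hy, rfl⟩
  have h := (Submodule.Quotient.mk_eq_zero _).2 this
  rw [Submodule.Quotient.mk_sub, Submodule.Quotient.mk_smul, sub_eq_zero] at h
  exact h

variable {F}
variable {W : Type w} [AddCommGroup W] [Module F W]

theorem hpGam_ext {f g : HpGam F V →ₗ[F] W}
    (h : ∀ a b : ZMod 2, ∀ x ∈ gr F V a, ∀ y ∈ gr F V b, f (hpMk F x y) = g (hpMk F x y)) :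
    f = g := by
  apply Submodule.linearMap_qext
  apply TensorProduct.ext'
  intro x y
  change f (hpMk F x y) = g (hpMk F x y)
  refine hp_ind F x (fun a x hx => ?_) (fun y y' h1 h2 => ?_)
  · refine hp_ind F y (fun b y hy => ?_) (fun y y' h1 h2 => ?_)
    · exact h a b x hx y hy
    · simp only [map_add, h1, h2]
  · simp only [map_add, h1, h2, LinearMap.add_apply]

theorem hpGam_lift (B : V →ₗ[F] V →ₗ[F] W)
    (hB : ∀ (a b : ZMod 2) (x y : V), x ∈ gr F V a → y ∈ gr F V b →
      B x y = sgn F a b • B y x) :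
    ∃ f : HpGam F V →ₗ[F] W, ∀ x y, f (hpMk F x y) = B x y := by
  refine ⟨(hpRel F V).liftQ (TensorProduct.lift B) ?_, ?_⟩
  · rw [hpRel, Submodule.span_le]
    rintro _ ⟨a, b, x, y, hx, hy, rfl⟩
    simp [← hB a b x y hx hy]
  · intro x y
    simp [hpMk]

theorem hpGam_data (h2 : (2 : F) ≠ 0) (d : GammaData F V W) (v : V) (hv : v ∈ gr F V 0) :
    d.gam v = (2 : F)⁻¹ • d.bil v v := by
  have h1 := d.gam_add v v hv hv
  have h3 := d.gam_smul 2 v hv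
  rw [← two_smul F v, h3] at h1
  rw [← h1, eq_inv_smul_iff₀ h2]
  module

theorem hpGam_iso (h2 : (2 : F) ≠ 0) (d : GammaData F V W) (hG : IsGamma F V W d) :
    Nonempty (HpGam F V ≃ₗ[F] W) := by
  obtain ⟨f, hf⟩ := hpGam_lift d.bil d.bil_symm
  let eΓ : ULift.{max u w} (HpGam F V) ≃ₗ[F] HpGam F V := ULift.moduleEquiv
  let eW : ULift.{max u v} W ≃ₗ[F] W := ULift.moduleEquiv
  let dΓ : GammaData F V (ULift.{max u w} (HpGam F V)) :=
    { gam := fun v => (2 : F)⁻¹ • eΓ.symm (hpMk F v v)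
      bil := (hpMk F).compr₂ eΓ.symm.toLinearMap
      gam_smul := by
        intro c v _
        simp only [map_smul, LinearMap.smul_apply]
        module
      gam_add := by
        intro x y hx hy
        have := hpMk_symm F 0 0 x y hx hy
        simp only [hp_sgn00, one_smul] at this
        simp only [map_add, LinearMap.add_apply, LinearMap.compr₂_apply,
          LinearEquiv.coe_coe, ← this]
        rw [← sub_eq_zero]
        have h4 : (2 : F)⁻¹ + (2 : F)⁻¹ = 1 := by field_simp; norm_num
        have h5 : eΓ.symm (hpMk F x y) = ((2 : F)⁻¹ + (2 : F)⁻¹) • eΓ.symm (hpMk F x y) := by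
          rw [h4, one_smul]
        nth_rewrite 3 [h5]
        module
      bil_symm := by
        intro a b x y hx hy
        simp [hpMk_symm F a b x y hx hy]
      bil_alt := by
        intro x hx
        have h := hpMk_symm F 1 1 x x hx hx
        rw [hp_sgn11, neg_smul, one_smul] at h
        have h' : (2 : F) • hpMk F x x = 0 := by
          rw [two_smul]; nth_rewrite 1 [h]; simp
        have h'' : hpMk F x x = 0 := (smul_eq_zero.1 h').resolve_left h2
        simp [h''] }
  let dW : GammaData F V (ULift.{max u v} W) :=
    { gam := fun v => eW.symm (d.gam v)
      bil := d.bil.compr₂ eW.symm.toLinearMap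
      gam_smul := by intro c v hv; simp [d.gam_smul c v hv]
      gam_add := by
        intro x y hx hy
        simp [← d.gam_add x y hx hy]
      bil_symm := by
        intro a b x y hx hy
        simp [d.bil_symm a b x y hx hy]
      bil_alt := by intro x hx; simp [d.bil_alt x hx] }
  obtain ⟨g, ⟨_, hg2⟩, -⟩ := hG _ dΓ
  have hgm : ∀ x y, eΓ (g (d.bil x y)) = hpMk F x y := by
    intro x y; rw [hg2]; simp [dΓ]
  obtain ⟨k, -, hk⟩ := hG _ dW
  have c1 : (eΓ.toLinearMap ∘ₗ g) ∘ₗ f = LinearMap.id := by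
    apply hpGam_ext
    intro a b x hx y hy
    simp [hf, hgm]
  have key : ∀ v w', f (eΓ (g (d.bil v w'))) = d.bil v w' := by
    intro v w'; rw [hgm, hf]
  have c2 : eW.symm.toLinearMap ∘ₗ (f ∘ₗ (eΓ.toLinearMap ∘ₗ g)) = eW.symm.toLinearMap := by
    rw [hk (eW.symm.toLinearMap ∘ₗ (f ∘ₗ (eΓ.toLinearMap ∘ₗ g))) ?_,
      hk eW.symm.toLinearMap ?_]
    · exact ⟨fun v hv => rfl, fun v w' => rfl⟩
    · refine ⟨fun v hv => ?_, fun v w' => ?_⟩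
      · simp only [LinearMap.comp_apply, LinearEquiv.coe_coe, hpGam_data h2 d v hv, map_smul, key,
          dW]
      · simp only [LinearMap.comp_apply, LinearEquiv.coe_coe, key, dW, LinearMap.compr₂_apply]
  refine ⟨LinearEquiv.ofLinearMap f (eΓ.toLinearMap ∘ₗ g) ?_ c1⟩
  ext w
  have := LinearMap.congr_fun c2 w
  exact eW.symm.injective this

end Gam

section Tens
variable {L : Type v} [AddCommGroup L] [Module F L] [SuperModule F L] [LieSuperAlgebra F L]

theorem hp_br_mem (x y : L) : br F L x y ∈ derivedSub F L := Submodule.subset_span ⟨x, y, rfl⟩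

theorem hpE_br_mem (x y : L) : hpE F L (br F L x y) ∈ derivedSub F L := by
  refine hp_ind F x (fun a x hx => ?_) (fun y y' h1 h2 => ?_)
  · refine hp_ind F y (fun b y hy => ?_) (fun y y' h1 h2 => ?_)
    · have := LieSuperAlgebra.bracket_grade a b x y hx hy
      rcases hp_zmod (a + b) with h | h <;> rw [h] at this
      · rw [hpE_even this]; exact hp_br_mem x y
      · rw [hpE_odd this]; exact Submodule.zero_mem _
    · rw [map_add, map_add]; exact Submodule.add_mem _ h1 h2
  · rw [map_add, LinearMap.add_apply, map_add]; exact Submodule.add_mem _ h1 h2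

theorem hpO_br_mem (x y : L) : hpO F L (br F L x y) ∈ derivedSub F L := by
  simpa [hpO] using Submodule.sub_mem _ (hp_br_mem x y) (hpE_br_mem x y)

/-- doubled module -/
@[reducible] def hpSuper (W : Type w) [AddCommGroup W] [Module F W] : SuperModule F (W × W) where
  grade a := if a = 0 then LinearMap.ker (LinearMap.snd F W W) else
    LinearMap.ker (LinearMap.fst F W W)
  isCompl_grade := by
    simp only [if_true, one_ne_zero, if_false]
    constructor
    · rw [Submodule.disjoint_def]
      rintro ⟨x, y⟩ h1 h2
      simp at h1 h2
      simp [h1, h2]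
    · rw [codisjoint_iff, eq_top_iff]
      rintro ⟨x, y⟩ -
      rw [Submodule.mem_sup]
      exact ⟨(x, 0), by simp, (0, y), by simp, by simp⟩

/-- zero bracket -/
@[reducible] def hpTriv (W : Type w) [AddCommGroup W] [Module F W] [SuperModule F W] :
    LieSuperAlgebra F W where
  bracket := 0
  bracket_grade := by intros; simp
  skew := by intros; simp
  jacobi := by intros; simp

theorem hp_tens {T : Type w} [AddCommGroup T] [Module F T] [SuperModule F T]
    [LieSuperAlgebra F T] (p : TensorSqPairing F L T) (hT : IsTensorSquare F L T p) :
    ∃ φ : T →ₗ[F] (L ⧸ derivedSub F L) ⊗[F] (L ⧸ derivedSub F L),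
      ∀ x y, φ (p.pair x y) = (derivedSub F L).mkQ x ⊗ₜ (derivedSub F L).mkQ y := by
  let W := (L ⧸ derivedSub F L) ⊗[F] (L ⧸ derivedSub F L)
  let W' := ULift.{max u w} W
  let e : W' ≃ₗ[F] W := ULift.moduleEquiv
  let : SuperModule F (W' × W') := hpSuper W'
  let : LieSuperAlgebra F (W' × W') := hpTriv (W' × W')
  let B : L →ₗ[F] L →ₗ[F] W' :=
    ((TensorProduct.mk F _ _).compl₁₂ (derivedSub F L).mkQ (derivedSub F L).mkQ).compr₂
      e.symm.toLinearMap
  have hB1 : ∀ z ∈ derivedSub F L, ∀ y, B z y = 0 := by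
    intro z hz y
    simp [B, (Submodule.Quotient.mk_eq_zero _).2 hz]
  have hB2 : ∀ z ∈ derivedSub F L, ∀ y, B y z = 0 := by
    intro z hz y
    simp [B, (Submodule.Quotient.mk_eq_zero _).2 hz]
  let P : L →ₗ[F] L →ₗ[F] (W' × W') :=
    (B.compl₁₂ (hpE F L) (hpE F L) + B.compl₁₂ (hpO F L) (hpO F L)).compr₂
        (LinearMap.inl F W' W') +
    (B.compl₁₂ (hpE F L) (hpO F L) + B.compl₁₂ (hpO F L) (hpE F L)).compr₂
        (LinearMap.inr F W' W')
  have hP1 : ∀ x y z, P (br F L x y) z = 0 := by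
    intro x y z
    simp only [P, LinearMap.add_apply, LinearMap.compr₂_apply, LinearMap.compl₁₂_apply,
      hB1 _ (hpE_br_mem x y), hB1 _ (hpO_br_mem x y), add_zero, map_zero]
  have hP2 : ∀ x y z, P z (br F L x y) = 0 := by
    intro x y z
    simp only [P, LinearMap.add_apply, LinearMap.compr₂_apply, LinearMap.compl₁₂_apply,
      hB2 _ (hpE_br_mem x y), hB2 _ (hpO_br_mem x y), add_zero, map_zero]
  have hg0 : ∀ t : W' × W', t ∈ gr F (W' × W') 0 ↔ t.2 = 0 := fun t => Iff.rfl
  have hg1 : ∀ t : W' × W', t ∈ gr F (W' × W') 1 ↔ t.1 = 0 := fun t => Iff.rfl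
  let q : TensorSqPairing F L (W' × W') :=
    { pair := P
      pair_grade := by
        intro a b x y hx hy
        have h11 : (1 + 1 : ZMod 2) = 0 := by decide
        rcases hp_zmod a with rfl | rfl <;> rcases hp_zmod b with rfl | rfl <;>
          simp only [h11, add_zero, zero_add, hg0, hg1] <;>
          simp [P, hpO_even, hpO_odd, hpE_even, hpE_odd, hx, hy]
      rel1 := by intros; simp only [hP1, hP2]; simp
      rel2 := by intros; simp only [hP1, hP2]; simp
      rel3 := by intros; simp only [hP1, smul_zero]; rfl }
  obtain ⟨h, hh, -⟩ := hT (W' × W') q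
  refine ⟨e.toLinearMap ∘ₗ (LinearMap.coprod LinearMap.id LinearMap.id) ∘ₗ h.toLinearMap, ?_⟩
  intro x y
  have : e (B x y) = (derivedSub F L).mkQ x ⊗ₜ (derivedSub F L).mkQ y := by simp [B]
  rw [← this]
  simp only [LinearMap.comp_apply, hh, LinearEquiv.coe_coe]
  congr 1
  nth_rewrite 2 [← hp_add (F := F) x, ← hp_add (F := F) y]
  simp [q, P]
  abel

variable {T : Type w} [AddCommGroup T] [Module F T] [SuperModule F T]
    [LieSuperAlgebra F T] (p : TensorSqPairing F L T)

/-- supersymmetrized pairing -/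
noncomputable def hpSym : L →ₗ[F] L →ₗ[F] T := p.pair + hpFlip p.pair

theorem hpSym_apply (a b : ZMod 2) (x y : L)
    (hx : x ∈ gr F L a) (hy : y ∈ gr F L b) :
    hpSym p x y = p.pair x y + sgn F a b • p.pair y x := by
  simp [hpSym, hpFlip_apply p.pair a b x y hx hy]

theorem hpSym_symm (a b : ZMod 2) (x y : L)
    (hx : x ∈ gr F L a) (hy : y ∈ gr F L b) :
    hpSym p x y = sgn F a b • hpSym p y x := by
  rw [hpSym_apply p a b x y hx hy, hpSym_apply p b a y x hy hx]
  rcases hp_zmod a with rfl | rfl <;> rcases hp_zmod b with rfl | rfl <;>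
    simp only [hp_sgn00, hp_sgn01, hp_sgn10, hp_sgn11] <;> module

theorem hpSym_cyc (a b c : ZMod 2) (x y z : L)
    (hx : x ∈ gr F L a) (hy : y ∈ gr F L b) (hz : z ∈ gr F L c) :
    sgn F a c • hpSym p x (br F L y z) = sgn F b a • hpSym p y (br F L z x)
      + sgn F c b • hpSym p z (br F L x y) := by
  rw [hpSym_apply p a (b + c) x _ hx (LieSuperAlgebra.bracket_grade b c y z hy hz),
    hpSym_apply p b (c + a) y _ hy (LieSuperAlgebra.bracket_grade c a z x hz hx),
    hpSym_apply p c (a + b) z _ hz (LieSuperAlgebra.bracket_grade a b x y hx hy),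
    p.rel2 a b c x y z hx hy hz, p.rel1 b c y z x hy hz,
    show br F L x y = _ from LieSuperAlgebra.skew a b x y hx hy]
  have h11 : (1 + 1 : ZMod 2) = 0 := by decide
  simp only [map_smul, LinearMap.smul_apply]
  rcases hp_zmod a with rfl | rfl <;> rcases hp_zmod b with rfl | rfl <;>
    rcases hp_zmod c with rfl | rfl <;>
    simp only [h11, add_zero, zero_add, hp_sgn00, hp_sgn01, hp_sgn10, hp_sgn11] <;> module

theorem hpSym_zero (h2 : (2 : F) ≠ 0) (a b c : ZMod 2) (x y z : L)
    (hx : x ∈ gr F L a) (hy : y ∈ gr F L b) (hz : z ∈ gr F L c) :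
    hpSym p x (br F L y z) = 0 := by
  have e1 := hpSym_cyc p b c a y z x hy hz hx
  have e2 := hpSym_cyc p c a b z x y hz hx hy
  have h : (2 : F) • (sgn F a c • hpSym p x (br F L y z)) = 0 := by
    rw [e1] at e2
    rw [two_smul]
    have := sub_eq_zero.2 e2
    rw [← neg_eq_zero, ← this]
    abel
  have h3 := (smul_eq_zero.1 h).resolve_left h2
  refine (smul_eq_zero.1 h3).resolve_left ?_
  rcases hp_zmod a with rfl | rfl <;> rcases hp_zmod c with rfl | rfl <;>
    simp [hp_sgn00, hp_sgn01, hp_sgn10, hp_sgn11]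

theorem hpSym_der (h2 : (2 : F) ≠ 0) (x z : L) (hz : z ∈ derivedSub F L) :
    hpSym p x z = 0 ∧ hpSym p z x = 0 := by
  induction hz using Submodule.span_induction with
  | zero => simp
  | add y z _ _ h1 h2 => simp [h1, h2]
  | smul c y _ h => simp [h]
  | mem z hz =>
    obtain ⟨y, z, rfl⟩ := hz
    refine hp_ind F x (fun a x hx => ?_) (fun x x' h1 h2 => ?_)
    · refine hp_ind F y (fun b y hy => ?_) (fun x x' h1 h2 => ?_)
      · refine hp_ind F z (fun c z hz => ?_) (fun x x' h1 h2 => ?_)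
        · have h := hpSym_zero p h2 a b c x y z hx hy hz
          refine ⟨h, ?_⟩
          rw [hpSym_symm p (b + c) a _ x (LieSuperAlgebra.bracket_grade b c y z hy hz) hx, h,
            smul_zero]
        · simp only [map_add, LinearMap.add_apply, h1, h2, add_zero, and_self]
      · simp only [map_add, LinearMap.add_apply, h1, h2, add_zero, and_self]
    · simp only [map_add, LinearMap.add_apply, h1, h2, add_zero, and_self]

theorem hp_main (h2 : (2 : F) ≠ 0) (hT : IsTensorSquare F L T p)
    {Q : Type x} [AddCommGroup Q] [Module F Q] [SuperModule F Q] [LieSuperAlgebra F Q]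
    (hQ : IsQuotientByDerived F L Q) :
    Nonempty (HpGam F Q ≃ₗ[F] squareBox F L T p) := by
  obtain ⟨f, hs, hk⟩ := hQ
  have hlift : ∀ (a : ZMod 2) (q : Q), q ∈ gr F Q a → ∃ x ∈ gr F L a, f.toLinearMap x = q := by
    intro a q hq
    obtain ⟨x, rfl⟩ := hs q
    have h0 := f.map_grade 0 _ (hpE_mem (F := F) x)
    have h1 := f.map_grade 1 _ (hpO_mem (F := F) x)
    have hx : f.toLinearMap (hpE F L x) + f.toLinearMap (hpO F L x) = f.toLinearMap x := by
      rw [← map_add, hp_add]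
    rcases hp_zmod a with rfl | rfl
    · refine ⟨_, hpE_mem (F := F) x, ?_⟩
      have := congrArg (hpE F Q) hx
      rwa [map_add, hpE_even h0, hpE_odd h1, hpE_even hq, add_zero] at this
    · refine ⟨_, hpO_mem (F := F) x, ?_⟩
      have := congrArg (hpO F Q) hx
      rwa [map_add, hpO_even h0, hpO_odd h1, hpO_odd hq, zero_add] at this
  obtain ⟨s, hsf⟩ := f.toLinearMap.exists_rightInverse_of_surjective (LinearMap.range_eq_top.2 hs)
  have hsf' : ∀ q, f.toLinearMap (s q) = q := fun q => LinearMap.congr_fun hsf q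
  have hsd : ∀ x, s (f.toLinearMap x) - x ∈ derivedSub F L := by
    intro x
    rw [← hk, LinearMap.mem_ker, map_sub, hsf', sub_self]
  let B : Q →ₗ[F] Q →ₗ[F] T := (hpSym p).compl₁₂ s s
  have hB : ∀ x y, B (f.toLinearMap x) (f.toLinearMap y) = hpSym p x y := by
    intro x y
    have e1 : s (f.toLinearMap x) = x + (s (f.toLinearMap x) - x) := by abel
    have e2 : s (f.toLinearMap y) = y + (s (f.toLinearMap y) - y) := by abel
    simp only [B, LinearMap.compl₁₂_apply]
    rw [e1, e2]
    generalize s (f.toLinearMap x) - x = x', s (f.toLinearMap y) - y = y',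
      hsd x = hx, hsd y = hy at *
    simp only [map_add, LinearMap.add_apply, (hpSym_der p h2 _ _ hx).2, (hpSym_der p h2 _ _ hy).1,
      add_zero]
  obtain ⟨Ψ, hΨ⟩ := hpGam_lift B (by
    intro a b q q' hq hq'
    obtain ⟨x, hx, rfl⟩ := hlift a q hq
    obtain ⟨y, hy, rfl⟩ := hlift b q' hq'
    rw [hB, hB, hpSym_symm p a b x y hx hy])
  obtain ⟨φ, hφ⟩ := hp_tens p hT
  let g : (L ⧸ derivedSub F L) →ₗ[F] Q := (derivedSub F L).liftQ f.toLinearMap hk.ge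
  let θ : T →ₗ[F] HpGam F Q := (hpRel F Q).mkQ ∘ₗ (TensorProduct.map g g) ∘ₗ φ
  have hθ : ∀ x y, θ (p.pair x y) = hpMk F (f.toLinearMap x) (f.toLinearMap y) := by
    intro x y
    simp [θ, hφ, g, hpMk]
  have hcomp : θ ∘ₗ Ψ = (2 : F) • LinearMap.id := by
    apply hpGam_ext
    intro a b q hq q' hq'
    have hsy := hpMk_symm F a b q q' hq hq'
    obtain ⟨x, hx, rfl⟩ := hlift a q hq
    obtain ⟨y, hy, rfl⟩ := hlift b q' hq'
    rw [LinearMap.comp_apply, hΨ, hB, hpSym_apply p a b x y hx hy, map_add, map_smul, hθ, hθ,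
      ← hsy, ← two_smul F]
    rfl
  have hinj : Function.Injective Ψ := by
    rw [← LinearMap.ker_eq_bot, LinearMap.ker_eq_bot']
    intro m hm
    have := LinearMap.congr_fun hcomp m
    rw [LinearMap.comp_apply, hm, map_zero] at this
    exact (smul_eq_zero.1 this.symm).resolve_left h2
  have hrange : LinearMap.range Ψ = squareBox F L T p := by
    apply le_antisymm
    · have : (squareBox F L T p).mkQ ∘ₗ Ψ = 0 := by
        apply hpGam_ext
        intro a b q hq q' hq'
        obtain ⟨x, hx, rfl⟩ := hlift a q hq
        obtain ⟨y, hy, rfl⟩ := hlift b q' hq'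
        rw [LinearMap.comp_apply, hΨ, hB, hpSym_apply p a b x y hx hy]
        simp only [LinearMap.zero_apply]
        exact (Submodule.Quotient.mk_eq_zero _).2
          (Submodule.subset_span (Or.inl ⟨a, b, x, y, hx, hy, rfl⟩))
      rw [LinearMap.range_le_iff_comap, eq_top_iff]
      intro m _
      exact (Submodule.Quotient.mk_eq_zero (squareBox F L T p)).1 (LinearMap.congr_fun this m)
    · rw [squareBox, Submodule.span_le]
      rintro t (⟨a, b, x, y, hx, hy, rfl⟩ | ⟨x, hx, rfl⟩)
      · exact ⟨hpMk F (f.toLinearMap x) (f.toLinearMap y), by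
          rw [hΨ, hB, hpSym_apply p a b x y hx hy]⟩
      · refine ⟨(2 : F)⁻¹ • hpMk F (f.toLinearMap x) (f.toLinearMap x), ?_⟩
        rw [map_smul, hΨ, hB, hpSym_apply p 0 0 x x hx hx, hp_sgn00, one_smul, ← two_smul F,
          inv_smul_smul₀ h2]
  exact ⟨(LinearEquiv.ofInjective Ψ hinj).trans (LinearEquiv.ofEq _ _ hrange)⟩

theorem hp_quot {Q : Type x} [AddCommGroup Q] [Module F Q] [SuperModule F Q]
    [LieSuperAlgebra F Q] (hQ : IsQuotientByDerived F L Q) : IsQuotientByDerived F Q Q := by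
  obtain ⟨f, hs, hk⟩ := hQ
  refine ⟨⟨LinearMap.id, fun _ _ h => h, fun _ _ => rfl⟩, fun x => ⟨x, rfl⟩, ?_⟩
  symm
  change derivedSub F Q = LinearMap.ker LinearMap.id
  rw [LinearMap.ker_id, eq_bot_iff, derivedSub, Submodule.span_le]
  rintro _ ⟨x, y, rfl⟩
  obtain ⟨x, rfl⟩ := hs x
  obtain ⟨y, rfl⟩ := hs y
  rw [← f.map_bracket]
  have : br F L x y ∈ LinearMap.ker f.toLinearMap := hk ▸ hp_br_mem x y
  simpa using this

end Tens
end Helpers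

theorem stmt_7 (F : Type*) [Field F] (hchar2 : ringChar F ≠ 2) (hchar3 : ringChar F ≠ 3)
    (M : Type*) [AddCommGroup M] [Module F M] [SuperModule F M] [LieSuperAlgebra F M] [FiniteDimensional F M]
    (T : Type*) [AddCommGroup T] [Module F T] [SuperModule F T] [LieSuperAlgebra F T]
    (p : TensorSqPairing F M T) (hT : IsTensorSquare F M T p)
    (Q : Type*) [AddCommGroup Q] [Module F Q] [SuperModule F Q] [LieSuperAlgebra F Q] (hQ : IsQuotientByDerived F M Q)
    (TQ : Type*) [AddCommGroup TQ] [Module F TQ] [SuperModule F TQ] [LieSuperAlgebra F TQ]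
    (pQ : TensorSqPairing F Q TQ) (hTQ : IsTensorSquare F Q TQ pQ)
    (G : Type*) [AddCommGroup G] [Module F G]
    (d : GammaData F Q G) (hG : IsGamma F Q G d) :
    Nonempty ((squareBox F M T p) ≃ₗ[F] (squareBox F Q TQ pQ)) ∧
    Nonempty ((squareBox F Q TQ pQ) ≃ₗ[F] G) := by
  have h2 := hp_two_ne hchar2
  obtain ⟨e1⟩ := hp_main p h2 hT hQ
  obtain ⟨e2⟩ := hp_main pQ h2 hTQ (hp_quot hQ)
  obtain ⟨e3⟩ := hpGam_iso h2 d hG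
  exact ⟨⟨e1.symm.trans e2⟩, ⟨e2.symm.trans e3⟩⟩
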